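/- (Orthogonality of the Alamouti part of the Silver code.) Let A_1 = [[1,0],[0,1]], A_2 = [[i,0],[0,−i]], A_3 = [[0,−1],[1,0]], A_4 = [[0,i],[i,0]] ∈ ℂ^{2×2}. Then A_l·A_mᴴ + A_m·A_lᴴ = 0 for all l ≠ m in {1,2,3,4}, and consequently for every number of receive antennas n_r and every channel matrix H ∈ ℂ^{n_r×2}, the four vectors ṽec(H·A_1), ṽec(H·A_2), ṽec(H·A_3), ṽec(H·A_4) ∈ ℝ^{4 n_r} are pairwise orthogonal; hence the top-left 4×4 block of the R-factor of the equivalent channel matrix of the Silver code is diagonal, for every H and n_r. -/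

import Mathlib

open Matrix Complex
open scoped RealInnerProductSpace

/-- Realified (column-stacked) vectorization of a complex matrix. -/
noncomputable def tvec {m n : ℕ} (X : Matrix (Fin m) (Fin n) ℂ) :
    EuclideanSpace ℝ (Fin n × Fin m × Fin 2) :=
  WithLp.toLp 2 fun p => if p.2.2 = 0 then (X p.2.1 p.1).re else (X p.2.1 p.1).im

/-- The four weight matrices of the Alamouti part of the Silver code. -/
noncomputable def silverA : Fin 4 → Matrix (Fin 2) (Fin 2) ℂ
  | 0 => !![1, 0; 0, 1]
  | 1 => !![Complex.I, 0; 0, -Complex.I]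
  | 2 => !![0, -1; 1, 0]
  | 3 => !![0, Complex.I; Complex.I, 0]

/-- The Euclidean inner product of realified vectorizations is the real part of the
Frobenius inner product of the matrices. -/
theorem inner_tvec {m n : ℕ} (X Y : Matrix (Fin m) (Fin n) ℂ) :
    ⟪tvec X, tvec Y⟫ = (X * Yᴴ).trace.re := by
  simp only [tvec, PiLp.inner_apply, Fintype.sum_prod_type, Fin.sum_univ_two, Matrix.trace,
    Matrix.diag, Matrix.mul_apply, Complex.re_sum]
  rw [Finset.sum_comm]
  refine Finset.sum_congr rfl fun i _ => Finset.sum_congr rfl fun j _ => ?_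
  simp
  ring

/-- If `A * Bᴴ` is skew-Hermitian, then `H * A` and `H * B` have orthogonal realified
vectorizations for every `H`. -/
theorem inner_tvec_mul_eq_zero {m n k : ℕ} {A B : Matrix (Fin n) (Fin k) ℂ}
    (h : A * Bᴴ + B * Aᴴ = 0) (H : Matrix (Fin m) (Fin n) ℂ) :
    ⟪tvec (H * A), tvec (H * B)⟫ = 0 := by
  have hsum : H * A * (H * B)ᴴ + H * B * (H * A)ᴴ = 0 := by
    calc H * A * (H * B)ᴴ + H * B * (H * A)ᴴ = H * (A * Bᴴ + B * Aᴴ) * Hᴴ := by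
          simp only [Matrix.conjTranspose_mul, Matrix.mul_add, Matrix.add_mul, Matrix.mul_assoc]
      _ = 0 := by simp [h]
  have hre := congrArg (fun M => (Matrix.trace M).re) hsum
  simp only [Matrix.trace_add, Complex.add_re, Matrix.trace_zero, Complex.zero_re,
    ← inner_tvec] at hre
  rw [real_inner_comm (tvec (H * A))] at hre
  linarith [real_inner_comm (tvec (H * A)) (tvec (H * B))]

theorem silverA_mul_conjTranspose_add {l m : Fin 4} (h : l ≠ m) :
    silverA l * (silverA m)ᴴ + silverA m * (silverA l)ᴴ = 0 := by
  fin_cases l <;> fin_cases m <;> first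
    | exact absurd rfl h
    | (ext i j
       fin_cases i <;> fin_cases j <;>
         simp [silverA, Matrix.vecMul, dotProduct])

/-- orthogonality of the Alamouti part of the Silver code:
`A_l·A_mᴴ + A_m·A_lᴴ = 0` for all `l ≠ m`, and consequently for every `n_r` and every
`H ∈ ℂ^{n_r×2}` the four vectors `ṽec(H·A_l)` are pairwise orthogonal: the top-left `4×4`
block of the `R`-factor of the equivalent channel matrix is diagonal, for every `H`
and `n_r`. -/
theorem stmt18 :
    (∀ l m : Fin 4, l ≠ m →
      silverA l * (silverA m)ᴴ + silverA m * (silverA l)ᴴ = 0) ∧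
    (∀ (nr : ℕ) (H : Matrix (Fin nr) (Fin 2) ℂ),
      ∀ l m : Fin 4, l ≠ m →
        ⟪tvec (H * silverA l), tvec (H * silverA m)⟫ = 0) := by
  exact ⟨fun _ _ h => silverA_mul_conjTranspose_add h,
    fun _ H _ _ h => inner_tvec_mul_eq_zero (silverA_mul_conjTranspose_add h) H⟩
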